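/- Let X ⊆ ℝ^d be nonempty, closed and convex; let f be L_f-smooth; let h : ℝ^d → ℝ be convex; let c = (c₁,…,c_m) satisfy, on X, |cᵢ| ≤ F, ‖∇cᵢ‖₂ ≤ M_c and L_c-smoothness of each cᵢ; let u be a random vector with E_u[u uᵀ] = I_d; let p ≥ 2 and q with 1/p + 1/q = 1... Suppose v is differentiable and 1-strongly convex w.r.t. the ℓ_q-norm, η > 0, μ > 0, ρ > 0, ρ_k ≥ 0, x^k ∈ X, λ^k ∈ ℝ^m with |λᵢ^k| ≤ ρF for all i, and s^k ∈ ℝ^d is any vector with error ε^k = s^k − g_ν(x^k). Let x^{k+1} = argmin_{x ∈ X} ⟨s^k + ∇c(x^k)ᵀ(λ^k + μc(x^k)), x⟩ + h(x) + (1/η)V(x^k, x) and λ^{k+1} = λ^k + ρ_k c(x^k). Then (1/(2η))‖x^{k+1} − x^k‖_q² − (L_μ/2)‖x^{k+1} − x^k‖₂² ≤ L(x^k, λ^k; μ) − L(x^{k+1}, λ^{k+1}; μ) + (ην²L_f²/4)·E_u[‖u‖₂⁶] + η‖ε^k‖_p² + m ρ_k F², where L_μ = L_f + m(μM_c² + μF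 L_c + ρF L_c). -/

import Mathlib

open MeasureTheory Finset
open scoped RealInnerProductSpace

/-- The ℓ_p norm on ℝ^d. -/
noncomputable def lpNorm {d : ℕ} (p : ℝ) (x : EuclideanSpace ℝ (Fin d)) : ℝ :=
  (∑ i, |x i| ^ p) ^ (1 / p)

/-- The augmented Lagrangian `L(x, λ; μ) = f(x) + h(x) + λᵀc(x) + (μ/2)‖c(x)‖₂²`. -/
noncomputable def AL {d m : ℕ} (f h : EuclideanSpace ℝ (Fin d) → ℝ)
    (c : Fin m → EuclideanSpace ℝ (Fin d) → ℝ) (μ : ℝ)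
    (x : EuclideanSpace ℝ (Fin d)) (lam : Fin m → ℝ) : ℝ :=
  f x + h x + ∑ i, lam i * c i x + μ / 2 * ∑ i, (c i x) ^ 2

theorem coordLpNorm_nonneg {d : ℕ} (p : ℝ) (x : EuclideanSpace ℝ (Fin d)) : 0 ≤ lpNorm p x := by
  unfold _root_.lpNorm
  positivity

theorem inner_le_coordLpNorm_mul {d : ℕ} {p q : ℝ} (hpq : p.HolderConjugate q)
    (x y : EuclideanSpace ℝ (Fin d)) : (⟪x, y⟫ : ℝ) ≤ lpNorm p x * lpNorm q y := by
  unfold _root_.lpNorm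
  have := Real.inner_le_Lp_mul_Lq univ x y hpq
  simpa [PiLp.inner_apply, mul_comm] using this

theorem coordLpNorm_le_norm {d : ℕ} {p : ℝ} (hp : 2 ≤ p) (x : EuclideanSpace ℝ (Fin d)) :
    lpNorm p x ≤ ‖x‖ := by
  unfold _root_.lpNorm
  have hp0 : 0 < p := by linarith
  have split : ∀ a : ℝ, 0 ≤ a → a ^ p = a ^ 2 * a ^ (p - 2) := fun a ha => by
    rw [← Real.rpow_natCast a 2, ← Real.rpow_add_of_nonneg ha (by norm_num) (by linarith)]
    congr 1
    push_cast
    ring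
  have hsum : ∑ i, |x i| ^ p ≤ ‖x‖ ^ p := by
    calc ∑ i, |x i| ^ p ≤ ∑ i, |x i| ^ 2 * ‖x‖ ^ (p - 2) := by
          refine sum_le_sum fun i _ => ?_
          rw [split _ (abs_nonneg _)]
          gcongr
          exact PiLp.norm_apply_le x i
      _ = ‖x‖ ^ p := by
          rw [← sum_mul, split _ (norm_nonneg x), EuclideanSpace.norm_sq_eq]
          simp
  calc (∑ i, |x i| ^ p) ^ (1 / p) ≤ (‖x‖ ^ p) ^ (1 / p) := by gcongr
    _ = ‖x‖ := by rw [← Real.rpow_mul (norm_nonneg x), mul_one_div_cancel hp0.ne', Real.rpow_one]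

section Smooth

variable {E : Type*} [NormedAddCommGroup E] [InnerProductSpace ℝ E] [CompleteSpace E]

theorem HasGradientAt.hasDerivAt_comp_line {f : E → ℝ} {x D g : E} {t : ℝ}
    (hf : HasGradientAt f g (x + t • D)) :
    HasDerivAt (fun s : ℝ => f (x + s • D)) ⟪g, D⟫ t := by
  have hline : HasDerivAt (fun s : ℝ => x + s • D) D t := by
    simpa using ((hasDerivAt_id t).smul_const D).const_add x
  simpa [Function.comp_def] using hf.hasFDerivAt.comp_hasDerivAt t hline

theorem Convex.abs_sub_sub_inner_le {s : Set E} (hs : Convex ℝ s) {f : E → ℝ} {f' : E → E} {L : ℝ}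
    (hf : ∀ x, HasGradientAt f (f' x) x)
    (hL : ∀ x ∈ s, ∀ y ∈ s, ‖f' x - f' y‖ ≤ L * ‖x - y‖) {x y : E} (hx : x ∈ s) (hy : y ∈ s) :
    |f y - f x - ⟪f' x, y - x⟫| ≤ L / 2 * ‖y - x‖ ^ 2 := by
  set D := y - x with hD
  have hder : ∀ t : ℝ, HasDerivAt (fun t : ℝ => f (x + t • D) - f x - t * ⟪f' x, D⟫)
      (⟪f' (x + t • D), D⟫ - ⟪f' x, D⟫) t := fun t => by
    have hlin : HasDerivAt (fun t : ℝ => t * (⟪f' x, D⟫ : ℝ)) ⟪f' x, D⟫ t := by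
      simpa using (hasDerivAt_id t).mul_const (⟪f' x, D⟫ : ℝ)
    exact ((hf (x + t • D)).hasDerivAt_comp_line.sub_const (f x)).sub hlin
  have hB : ∀ t : ℝ, HasDerivAt (fun t : ℝ => L / 2 * ‖D‖ ^ 2 * t ^ 2) (L * ‖D‖ ^ 2 * t) t :=
    fun t => by
      refine ((hasDerivAt_pow 2 t).const_mul (L / 2 * ‖D‖ ^ 2)).congr_deriv ?_
      norm_num
      ring
  have key := image_norm_le_of_norm_deriv_right_le_deriv_boundary (a := 0) (b := 1)
    (fun t _ => (hder t).continuousAt.continuousWithinAt)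
    (fun t _ => (hder t).hasDerivWithinAt) (by simp) hB
    (fun t ht => by
      have hmem : x + t • D ∈ s := hs.add_smul_sub_mem hx hy ⟨ht.1, ht.2.le⟩
      rw [← inner_sub_left]
      calc ‖(⟪f' (x + t • D) - f' x, D⟫ : ℝ)‖ ≤ ‖f' (x + t • D) - f' x‖ * ‖D‖ :=
            norm_inner_le_norm _ _
        _ ≤ L * ‖x + t • D - x‖ * ‖D‖ := by gcongr; exact hL _ hmem _ hx
        _ = L * ‖D‖ ^ 2 * t := by
            rw [add_sub_cancel_left, norm_smul, Real.norm_of_nonneg ht.1]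
            ring)
    (Set.right_mem_Icc.2 zero_le_one)
  simpa [hD] using key

theorem Convex.abs_sub_le_of_gradient_le {s : Set E} (hs : Convex ℝ s) {f : E → ℝ} {f' : E → E}
    {M : ℝ} (hf : ∀ x, HasGradientAt f (f' x) x) (hM : ∀ x ∈ s, ‖f' x‖ ≤ M) {x y : E}
    (hx : x ∈ s) (hy : y ∈ s) : |f y - f x| ≤ M * ‖y - x‖ := by
  have := hs.norm_image_sub_le_of_norm_hasFDerivWithin_le (C := M)
    (fun z _ => (hf z).hasFDerivAt.hasFDerivWithinAt)
    (fun z hz => by simpa using hM z hz) hx hy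
  simpa using this

/-- First-order optimality in a linear + convex + differentiable problem, tested at `z`. -/
theorem Convex.inner_add_sub_le_of_isMin {s : Set E} (hs : Convex ℝ s) {h w : E → ℝ} {G w' x z : E}
    (hh : ConvexOn ℝ Set.univ h) (hw : HasGradientAt w w' x) (hx : x ∈ s) (hz : z ∈ s)
    (hmin : ∀ y ∈ s, ⟪G, x⟫ + h x + w x ≤ ⟪G, y⟫ + h y + w y) :
    0 ≤ ⟪G + w', z - x⟫ + (h z - h x) := by
  have hder : HasDerivAt (fun t : ℝ => w (x + t • (z - x))) ⟪w', z - x⟫ 0 :=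
    HasGradientAt.hasDerivAt_comp_line (by simpa using hw)
  have htend := hder.tendsto_slope_zero_right
  have hbound : -(⟪G, z - x⟫ + (h z - h x)) ≤ (⟪w', z - x⟫ : ℝ) := by
    refine ge_of_tendsto htend ?_
    filter_upwards [Ioo_mem_nhdsGT (zero_lt_one' ℝ)] with t ht
    have h1 := hmin _ (hs.add_smul_sub_mem hx hz ⟨ht.1.le, ht.2.le⟩)
    have h2 : h (x + t • (z - x)) ≤ (1 - t) * h x + t * h z := by
      have := hh.2 (Set.mem_univ x) (Set.mem_univ z) (sub_nonneg.2 ht.2.le) ht.1.le (by ring)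
      have e : x + t • (z - x) = (1 - t) • x + t • z := by module
      simpa [e] using this
    rw [inner_add_right, inner_smul_right] at h1
    simp only [zero_add, zero_smul, add_zero, smul_eq_mul]
    rw [inv_mul_eq_div, le_div_iff₀ ht.1]
    linarith
  rw [inner_add_left]
  linarith

end Smooth

section Smoothing

variable {Ω : Type*} [MeasurableSpace Ω] {P : Measure Ω}

theorem integrable_inner_smul_self {E : Type*} [NormedAddCommGroup E] [InnerProductSpace ℝ E]
    {u : Ω → E} (hu : AEStronglyMeasurable u P) (hmom : Integrable (fun ω => ‖u ω‖ ^ 2) P) (g : E) :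
    Integrable (fun ω => (⟪g, u ω⟫ : ℝ) • u ω) P := by
  refine (hmom.const_mul ‖g‖).mono' ((aestronglyMeasurable_const.inner hu).smul hu)
    (.of_forall fun ω => ?_)
  rw [norm_smul, sq, ← mul_assoc]
  gcongr
  exact norm_inner_le_norm _ _

theorem integral_inner_smul_self_eq {d : ℕ} {u : Ω → EuclideanSpace ℝ (Fin d)}
    (hu : AEStronglyMeasurable u P) (hmom : Integrable (fun ω => ‖u ω‖ ^ 2) P)
    (hId : ∀ i j, (∫ ω, u ω i * u ω j ∂P) = if i = j then (1 : ℝ) else 0)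
    (g : EuclideanSpace ℝ (Fin d)) : ∫ ω, (⟪g, u ω⟫ : ℝ) • u ω ∂P = g := by
  have hint := integrable_inner_smul_self hu hmom g
  have hcoord : ∀ i, AEStronglyMeasurable (fun ω => u ω i) P := fun i =>
    (EuclideanSpace.proj (𝕜 := ℝ) i).continuous.comp_aestronglyMeasurable hu
  have hij : ∀ i j, Integrable (fun ω => u ω i * u ω j) P := fun i j => by
    refine hmom.mono' ((hcoord i).mul (hcoord j)) (.of_forall fun ω => ?_)
    rw [norm_mul, sq]
    gcongr <;> exact PiLp.norm_apply_le _ _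
  ext j
  calc (∫ ω, (⟪g, u ω⟫ : ℝ) • u ω ∂P) j = ∫ ω, ((⟪g, u ω⟫ : ℝ) • u ω) j ∂P :=
        ((EuclideanSpace.proj (𝕜 := ℝ) j).integral_comp_comm hint).symm
    _ = ∫ ω, ∑ i, g i * (u ω i * u ω j) ∂P := by
        congr 1 with ω
        simp only [PiLp.smul_apply, PiLp.inner_apply, smul_eq_mul, sum_mul]
        refine sum_congr rfl fun i _ => ?_
        simp
        ring
    _ = g j := by
        rw [integral_finsetSum _ fun i _ => (hij i j).const_mul _]
        simp [integral_const_mul, hId]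

/-- The bias of the smoothed gradient of an `L`-smooth function. -/
theorem norm_smoothedGradient_sub_le [IsProbabilityMeasure P] {d : ℕ} {f : EuclideanSpace ℝ (Fin d) → ℝ}
    {f' : EuclideanSpace ℝ (Fin d) → EuclideanSpace ℝ (Fin d)} {L ν : ℝ} (hν : 0 < ν)
    (hf : ∀ x, HasGradientAt f (f' x) x) (hL : ∀ x y, ‖f' x - f' y‖ ≤ L * ‖x - y‖)
    {u : Ω → EuclideanSpace ℝ (Fin d)} (hu : AEStronglyMeasurable u P)
    (hmom : Integrable (fun ω => ‖u ω‖ ^ 3) P)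
    (hId : ∀ i j, (∫ ω, u ω i * u ω j ∂P) = if i = j then (1 : ℝ) else 0)
    (x : EuclideanSpace ℝ (Fin d)) :
    ‖(∫ ω, ((f (x + ν • u ω) - f x) / ν) • u ω ∂P) - f' x‖
      ≤ ν * L / 2 * ∫ ω, ‖u ω‖ ^ 3 ∂P := by
  have hcont : Continuous f := continuous_iff_continuousAt.2 fun x => (hf x).continuousAt
  have hsq : Integrable (fun ω => ‖u ω‖ ^ 2) P :=
    integrable_norm_pow_of_le hu (by norm_num) hmom
  have hlin := integrable_inner_smul_self hu hsq (f' x)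
  have hmeas : AEStronglyMeasurable (fun ω => ((f (x + ν • u ω) - f x) / ν) • u ω) P :=
    (by fun_prop : Continuous fun w => ((f (x + ν • w) - f x) / ν) • w).comp_aestronglyMeasurable hu
  have hbd : ∀ ω, ‖((f (x + ν • u ω) - f x) / ν) • u ω - (⟪f' x, u ω⟫ : ℝ) • u ω‖
      ≤ ν * L / 2 * ‖u ω‖ ^ 3 := fun ω => by
    have h1 := convex_univ.abs_sub_sub_inner_le hf (fun x _ y _ => hL x y)
      (Set.mem_univ x) (Set.mem_univ (x + ν • u ω))
    rw [add_sub_cancel_left, inner_smul_right, norm_smul, Real.norm_of_nonneg hν.le] at h1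
    have h2 : (f (x + ν • u ω) - f x) / ν - ⟪f' x, u ω⟫
        = (f (x + ν • u ω) - f x - ν * ⟪f' x, u ω⟫) / ν := by
      field_simp
    rw [← sub_smul, norm_smul, h2, Real.norm_eq_abs, abs_div, abs_of_pos hν]
    calc _ ≤ L / 2 * (ν * ‖u ω‖) ^ 2 / ν * ‖u ω‖ := by gcongr
      _ = ν * L / 2 * ‖u ω‖ ^ 3 := by
        field_simp
  have hdiff : Integrable (fun ω => ((f (x + ν • u ω) - f x) / ν) • u ω
      - (⟪f' x, u ω⟫ : ℝ) • u ω) P :=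
    (hmom.const_mul (ν * L / 2)).mono' (hmeas.sub hlin.aestronglyMeasurable) (.of_forall hbd)
  have hfull : Integrable (fun ω => ((f (x + ν • u ω) - f x) / ν) • u ω) P := by
    refine (hdiff.add hlin).congr (.of_forall fun ω => ?_)
    simp
  calc _ = ‖∫ ω, (((f (x + ν • u ω) - f x) / ν) • u ω - (⟪f' x, u ω⟫ : ℝ) • u ω) ∂P‖ := by
        rw [integral_sub hfull hlin, integral_inner_smul_self_eq hu hsq hId]
    _ ≤ ∫ ω, ν * L / 2 * ‖u ω‖ ^ 3 ∂P :=
        norm_integral_le_of_norm_le (hmom.const_mul _) (.of_forall hbd)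
    _ = _ := integral_const_mul _ _

theorem sq_integral_le_integral_sq [IsProbabilityMeasure P] {X : Ω → ℝ} (hX : Integrable X P)
    (hX2 : Integrable (fun ω => X ω ^ 2) P) : (∫ ω, X ω ∂P) ^ 2 ≤ ∫ ω, X ω ^ 2 ∂P := by
  have h := ProbabilityTheory.variance_nonneg X P
  rw [ProbabilityTheory.variance_eq_sub
    ((memLp_two_iff_integrable_sq hX.aestronglyMeasurable).2 hX2)] at h
  simpa using h

end Smoothing

/-- Lemma 4.4: descent property of the augmented Lagrangian along one step of
the Bregman linearized augmented Lagrangian method. -/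
theorem AL_descent
    {d m : ℕ} {p q η μ ρ ρk ν Lf F Mc Lc : ℝ}
    (hp : 2 ≤ p) (hpq : 1 / p + 1 / q = 1)
    (hη : 0 < η) (hμ : 0 < μ) (hρ : 0 < ρ) (hρk : 0 ≤ ρk) (hν : 0 < ν)
    (X : Set (EuclideanSpace ℝ (Fin d)))
    (hXne : X.Nonempty) (hXcl : IsClosed X) (hXconv : Convex ℝ X)
    -- `f` is `L_f`-smooth
    (f : EuclideanSpace ℝ (Fin d) → ℝ)
    (f' : EuclideanSpace ℝ (Fin d) → EuclideanSpace ℝ (Fin d))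
    (hdf : ∀ x, HasGradientAt f (f' x) x)
    (hLf : ∀ x y, ‖f' x - f' y‖ ≤ Lf * ‖x - y‖)
    -- `h` is convex
    (h : EuclideanSpace ℝ (Fin d) → ℝ) (hconv : ConvexOn ℝ Set.univ h)
    -- constraints
    (c : Fin m → EuclideanSpace ℝ (Fin d) → ℝ)
    (c' : Fin m → EuclideanSpace ℝ (Fin d) → EuclideanSpace ℝ (Fin d))
    (hdc : ∀ i x, HasGradientAt (c i) (c' i x) x)
    (hcF : ∀ i, ∀ x ∈ X, |c i x| ≤ F)
    (hgc : ∀ i, ∀ x ∈ X, ‖c' i x‖ ≤ Mc)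
    (hcL : ∀ i, ∀ x ∈ X, ∀ y ∈ X, ‖c' i x - c' i y‖ ≤ Lc * ‖x - y‖)
    -- the random direction `u` with `E[uuᵀ] = I_d`
    {Ω : Type*} [MeasurableSpace Ω] (μu : Measure Ω) [IsProbabilityMeasure μu]
    (u : Ω → EuclideanSpace ℝ (Fin d)) (hu : Measurable u)
    (hmom : Integrable (fun ω => ‖u ω‖ ^ 6) μu)
    (hId : ∀ i j, (∫ ω, u ω i * u ω j ∂μu) = if i = j then (1:ℝ) else 0)
    -- `v` is differentiable and 1-strongly convex w.r.t. the ℓ_q-norm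
    (v : EuclideanSpace ℝ (Fin d) → ℝ)
    (v' : EuclideanSpace ℝ (Fin d) → EuclideanSpace ℝ (Fin d))
    (hv : ∀ z, HasGradientAt v (v' z) z)
    (hsc : ∀ a b, (⟪a - b, v' a - v' b⟫ : ℝ) ≥ (lpNorm q (a - b)) ^ 2)
    -- current iterates and the stochastic gradient `s^k` with error `ε^k = s^k − g_ν(x^k)`
    (xk : EuclideanSpace ℝ (Fin d)) (hxk : xk ∈ X)
    (lamk : Fin m → ℝ) (hlamk : ∀ i, |lamk i| ≤ ρ * F)
    (sk eps : EuclideanSpace ℝ (Fin d))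
    (heps : eps = sk - ∫ ω, ((f (xk + ν • u ω) - f xk) / ν) • u ω ∂μu)
    -- the next primal iterate: minimizer of the linearized proximal subproblem over `X`
    (xk1 : EuclideanSpace ℝ (Fin d)) (hxk1X : xk1 ∈ X)
    (hxk1min : ∀ z ∈ X,
      (⟪sk + ∑ i, (lamk i + μ * c i xk) • c' i xk, xk1⟫ : ℝ) + h xk1
          + (1 / η) * (v xk1 - v xk - (⟪v' xk, xk1 - xk⟫ : ℝ))
        ≤ (⟪sk + ∑ i, (lamk i + μ * c i xk) • c' i xk, z⟫ : ℝ) + h z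
          + (1 / η) * (v z - v xk - (⟪v' xk, z - xk⟫ : ℝ)))
    -- the next dual iterate
    (lamk1 : Fin m → ℝ) (hlamk1 : ∀ i, lamk1 i = lamk i + ρk * c i xk) :
    1 / (2 * η) * (lpNorm q (xk1 - xk)) ^ 2
        - (Lf + m * (μ * Mc ^ 2 + μ * F * Lc + ρ * F * Lc)) / 2 * ‖xk1 - xk‖ ^ 2
      ≤ AL f h c μ xk lamk - AL f h c μ xk1 lamk1
        + η * ν ^ 2 * Lf ^ 2 / 4 * (∫ ω, ‖u ω‖ ^ 6 ∂μu)
        + η * (lpNorm p eps) ^ 2 + m * ρk * F ^ 2 := by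
  have hpqc : p.HolderConjugate q := by
    refine Real.holderConjugate_iff.2 ⟨by linarith, ?_⟩
    simpa using hpq
  have hum := hu.aestronglyMeasurable (μ := μu)
  set D := xk1 - xk with hD
  set g := ∫ ω, ((f (xk + ν • u ω) - f xk) / ν) • u ω ∂μu with hg
  set G := sk + ∑ i, (lamk i + μ * c i xk) • c' i xk with hG
  set N := lpNorm q D with hN
  -- optimality of the subproblem
  have hopt : (⟪G, D⟫ : ℝ) + h xk1 - h xk + 1 / η * N ^ 2 ≤ 0 := by
    have hw : HasGradientAt (fun z => 1 / η * (v z - v xk - (⟪v' xk, z - xk⟫ : ℝ)))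
        ((1 / η) • (v' xk1 - v' xk)) xk1 := by
      rw [hasGradientAt_iff_hasFDerivAt, map_smul, map_sub]
      have hl : HasFDerivAt (fun z => (⟪v' xk, z - xk⟫ : ℝ))
          (InnerProductSpace.toDual ℝ _ (v' xk)) xk1 := by
        simpa [inner_sub_right] using
          (InnerProductSpace.toDual ℝ _ (v' xk)).hasFDerivAt.sub_const (⟪v' xk, xk⟫ : ℝ)
      exact (((hv xk1).hasFDerivAt.sub_const (v xk)).sub hl).const_mul (1 / η)
    have h1 := hXconv.inner_add_sub_le_of_isMin hconv hw hxk1X hxk hxk1min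
    have h2 := hsc xk1 xk
    have h3 : 1 / η * N ^ 2 ≤ 1 / η * ⟪v' xk1 - v' xk, D⟫ := by
      rw [real_inner_comm]
      gcongr
    rw [← neg_sub xk1 xk, inner_neg_right, inner_add_left, real_inner_smul_left] at h1
    linarith
  -- bias and noise of the gradient estimate
  have hbias : lpNorm p (g - f' xk) ^ 2 ≤ ν ^ 2 * Lf ^ 2 / 4 * ∫ ω, ‖u ω‖ ^ 6 ∂μu := by
    have hcube : Integrable (fun ω => ‖u ω‖ ^ 3) μu := integrable_norm_pow_of_le hum (by norm_num) hmom
    have h1 := (coordLpNorm_le_norm hp _).trans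
      (norm_smoothedGradient_sub_le hν hdf hLf hum hcube hId xk)
    have h2 : (∫ ω, ‖u ω‖ ^ 3 ∂μu) ^ 2 ≤ ∫ ω, ‖u ω‖ ^ 6 ∂μu := by
      simpa only [← pow_mul] using sq_integral_le_integral_sq hcube
        (by simpa only [← pow_mul] using hmom)
    calc lpNorm p (g - f' xk) ^ 2 ≤ (ν * Lf / 2 * ∫ ω, ‖u ω‖ ^ 3 ∂μu) ^ 2 :=
          pow_le_pow_left₀ (coordLpNorm_nonneg _ _) h1 2
      _ = ν ^ 2 * Lf ^ 2 / 4 * (∫ ω, ‖u ω‖ ^ 3 ∂μu) ^ 2 := by ring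
      _ ≤ _ := by gcongr
  have hyoung : ∀ e : EuclideanSpace ℝ (Fin d),
      -(⟪e, D⟫ : ℝ) ≤ η * lpNorm p e ^ 2 + 1 / (4 * η) * N ^ 2 := fun e => by
    have h1 := inner_le_coordLpNorm_mul hpqc e (-D)
    have h2 : lpNorm q (-D) = N := by simp [hN, _root_.lpNorm]
    rw [inner_neg_right, h2] at h1
    have h3 : η * lpNorm p e ^ 2 + 1 / (4 * η) * N ^ 2 - lpNorm p e * N
        = 1 / (4 * η) * (2 * η * lpNorm p e - N) ^ 2 := by
      field_simp
      ring
    have h4 : 0 ≤ 1 / (4 * η) * (2 * η * lpNorm p e - N) ^ 2 := by positivity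
    linarith
  have hy1 := hyoung eps
  have hy2 := hyoung (g - f' xk)
  have hbias' := mul_le_mul_of_nonneg_left hbias hη.le
  -- smoothness of the objective and of the constraints
  have hfd := (abs_le.1 (convex_univ.abs_sub_sub_inner_le hdf (fun x _ y _ => hLf x y)
    (Set.mem_univ xk) (Set.mem_univ xk1))).2
  have hci : ∀ i, lamk1 i * c i xk1 + μ / 2 * c i xk1 ^ 2
      ≤ lamk i * c i xk + μ / 2 * c i xk ^ 2 + (lamk i + μ * c i xk) * ⟪c' i xk, D⟫
        + (μ * Mc ^ 2 + μ * F * Lc + ρ * F * Lc) / 2 * ‖D‖ ^ 2 + ρk * F ^ 2 := fun i => by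
    have hr := hXconv.abs_sub_sub_inner_le (hdc i) (hcL i) hxk hxk1X
    have hm := hXconv.abs_sub_le_of_gradient_le (hdc i) (hgc i) hxk hxk1X
    rw [← hD] at hr hm
    have hF : 0 ≤ F := (abs_nonneg _).trans (hcF i xk hxk)
    have h1 : (lamk i + μ * c i xk) * (c i xk1 - c i xk - ⟪c' i xk, D⟫)
        ≤ (ρ * F + μ * F) * (Lc / 2 * ‖D‖ ^ 2) := by
      refine (le_abs_self _).trans ?_
      rw [abs_mul]
      refine mul_le_mul ((abs_add_le _ _).trans (add_le_add (hlamk i) ?_)) hr (abs_nonneg _)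
        (by positivity)
      rw [abs_mul, abs_of_pos hμ]
      gcongr
      exact hcF i xk hxk
    have h2 : (c i xk1 - c i xk) ^ 2 ≤ (Mc * ‖D‖) ^ 2 := by
      rw [← sq_abs]
      exact pow_le_pow_left₀ (abs_nonneg _) hm 2
    have h3 : c i xk * c i xk1 ≤ F ^ 2 := by
      refine (le_abs_self _).trans ?_
      rw [abs_mul, sq]
      exact mul_le_mul (hcF i xk hxk) (hcF i xk1 hxk1X) (abs_nonneg _) hF
    rw [hlamk1]
    linear_combination h1 + μ / 2 * h2 + ρk * h3
  have hsum := sum_le_sum fun i (_ : i ∈ univ) => hci i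
  simp only [sum_add_distrib, ← mul_sum, sum_const, card_univ, Fintype.card_fin,
    nsmul_eq_mul] at hsum
  have hGD : (⟪G, D⟫ : ℝ) = ⟪eps, D⟫ + ⟪g - f' xk, D⟫ + ⟪f' xk, D⟫
      + ∑ i, (lamk i + μ * c i xk) * ⟪c' i xk, D⟫ := by
    rw [hG, heps]
    simp only [inner_add_left, inner_sub_left, sum_inner, real_inner_smul_left]
    ring
  have hsplit : 1 / η * N ^ 2 = 1 / (2 * η) * N ^ 2 + 1 / (4 * η) * N ^ 2 + 1 / (4 * η) * N ^ 2 := by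
    field_simp
    ring
  unfold AL
  linarith
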